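/- (One-step forward dynamic-programming update.) Let F ∈ ℝ^{n×n}, H ∈ ℝ^{m×n}, let Q, P ∈ ℝ^{n×n} and R ∈ ℝ^{m×m} be symmetric positive definite, let x̆ ∈ ℝⁿ, y ∈ ℝ^m and c ∈ ℝ. Define P⁺ = Q + F P Fᵀ − F P Hᵀ (R + H P Hᵀ)⁻¹ H P Fᵀ, x̆⁺ = F x̆ + F P Hᵀ (R + H P Hᵀ)⁻¹ (y − H x̆), c⁺ = c + |H x̆ − y|²_{(R + H P Hᵀ)⁻¹}, and S = Fᵀ Q⁻¹ F + Hᵀ R⁻¹ H + P⁻¹. Then for every x ∈ ℝⁿ, the function ξ ↦ |x − F ξ|²_{Q⁻¹} + |y − H ξ|²_{R⁻¹} + |ξ − x̆|²_{P⁻¹} + c attains its minimum over ξ ∈ ℝⁿ at ξ* = S⁻¹ ( Fᵀ Q⁻¹ x + Hᵀ R⁻¹ y + P⁻¹ x̆ ), and the minimum value equals |x − x̆⁺|²_{(P⁺)⁻¹} + c⁺. -/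

import Mathlib

open Matrix

/-- Weighted squared norm `|z|²_M = zᵀ M z`. -/
noncomputable def qf {k : ℕ} (M : Matrix (Fin k) (Fin k) ℝ) (z : Fin k → ℝ) : ℝ :=
  z ⬝ᵥ M *ᵥ z

theorem qf_sub {k : ℕ} {A : Matrix (Fin k) (Fin k) ℝ} (hA : Aᵀ = A) (u v : Fin k → ℝ) :
    qf A (u - v) = qf A u - 2 * (u ⬝ᵥ A *ᵥ v) + qf A v := by
  have h : v ⬝ᵥ A *ᵥ u = u ⬝ᵥ A *ᵥ v := by
    rw [dotProduct_mulVec, ← mulVec_transpose, hA, dotProduct_comm]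
  simp only [qf, mulVec_sub, dotProduct_sub, sub_dotProduct, h]
  ring

theorem qf_add_matrix {k : ℕ} (A B : Matrix (Fin k) (Fin k) ℝ) (v : Fin k → ℝ) :
    qf (A + B) v = qf A v + qf B v := by
  simp only [qf, add_mulVec, dotProduct_add]

theorem qf_mulVec {k l : ℕ} (A : Matrix (Fin k) (Fin k) ℝ) (B : Matrix (Fin k) (Fin l) ℝ)
    (v : Fin l → ℝ) : qf A (B *ᵥ v) = qf (Bᵀ * A * B) v := by
  simp only [qf, ← mulVec_mulVec, dotProduct_mulVec _ Bᵀ, vecMul_transpose]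

theorem qf_neg {k : ℕ} (A : Matrix (Fin k) (Fin k) ℝ) (v : Fin k → ℝ) :
    qf A (-v) = qf A v := by
  simp only [qf, mulVec_neg, neg_dotProduct_neg]

theorem qf_nonneg {k : ℕ} {A : Matrix (Fin k) (Fin k) ℝ} (hA : A.PosDef) (v : Fin k → ℝ) :
    0 ≤ qf A v := by
  simpa [qf] using hA.posSemidef.dotProduct_mulVec_nonneg v

theorem qf_zero {k : ℕ} (A : Matrix (Fin k) (Fin k) ℝ) : qf A 0 = 0 := by
  simp [qf]

theorem Matrix.PosDef.transpose_eq_self {k : ℕ} {A : Matrix (Fin k) (Fin k) ℝ}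
    (hA : A.PosDef) : Aᵀ = A := by
  simpa using hA.isHermitian.eq

section MeasurementUpdate

variable {n m : ℕ} {P : Matrix (Fin n) (Fin n) ℝ} {R : Matrix (Fin m) (Fin m) ℝ}

theorem posDef_information (hP : P.PosDef) (hR : R.PosDef) (H : Matrix (Fin m) (Fin n) ℝ) :
    (Hᵀ * R⁻¹ * H + P⁻¹).PosDef := by
  have h := hR.inv.posSemidef.conjTranspose_mul_mul_same H
  rw [conjTranspose_eq_transpose_of_trivial] at h
  exact PosDef.posSemidef_add h hP.inv

theorem posDef_innovation (hP : P.PosDef) (hR : R.PosDef) (H : Matrix (Fin m) (Fin n) ℝ) :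
    (R + H * P * Hᵀ).PosDef := by
  have h := hP.posSemidef.mul_mul_conjTranspose_same H
  rw [conjTranspose_eq_transpose_of_trivial] at h
  exact hR.add_posSemidef h

theorem information_mul_gain (hP : P.PosDef) (hR : R.PosDef) (H : Matrix (Fin m) (Fin n) ℝ) :
    (Hᵀ * R⁻¹ * H + P⁻¹) * (P * Hᵀ * (R + H * P * Hᵀ)⁻¹) = Hᵀ * R⁻¹ := by
  have hdP := (isUnit_iff_isUnit_det _).1 hP.isUnit
  have hdR := (isUnit_iff_isUnit_det _).1 hR.isUnit
  have hdW := (isUnit_iff_isUnit_det _).1 (posDef_innovation hP hR H).isUnit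
  have h : (Hᵀ * R⁻¹ * H + P⁻¹) * (P * Hᵀ) = Hᵀ * R⁻¹ * (R + H * P * Hᵀ) := by
    rw [Matrix.add_mul, Matrix.mul_add, nonsing_inv_mul_cancel_left _ _ hdP,
      nonsing_inv_mul_cancel_right _ _ hdR, add_comm]
    simp only [Matrix.mul_assoc]
  rw [← Matrix.mul_assoc, h, mul_nonsing_inv_cancel_right _ _ hdW]

theorem inv_information (hP : P.PosDef) (hR : R.PosDef) (H : Matrix (Fin m) (Fin n) ℝ) :
    (Hᵀ * R⁻¹ * H + P⁻¹)⁻¹ = P - P * Hᵀ * (R + H * P * Hᵀ)⁻¹ * (H * P) := by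
  have hdP := (isUnit_iff_isUnit_det _).1 hP.isUnit
  apply inv_eq_right_inv
  rw [Matrix.mul_sub, ← Matrix.mul_assoc _ _ (H * P), information_mul_gain hP hR H,
    Matrix.add_mul, nonsing_inv_mul _ hdP]
  simp only [Matrix.mul_assoc]
  abel

theorem inv_information_mulVec (hP : P.PosDef) (hR : R.PosDef) (H : Matrix (Fin m) (Fin n) ℝ)
    (y : Fin m → ℝ) (z : Fin n → ℝ) :
    (Hᵀ * R⁻¹ * H + P⁻¹)⁻¹ *ᵥ (Hᵀ *ᵥ (R⁻¹ *ᵥ y) + P⁻¹ *ᵥ z) =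
      z + (P * Hᵀ * (R + H * P * Hᵀ)⁻¹) *ᵥ (y - H *ᵥ z) := by
  have hdS := (isUnit_iff_isUnit_det _).1 (posDef_information hP hR H).isUnit
  have h : Hᵀ *ᵥ (R⁻¹ *ᵥ y) + P⁻¹ *ᵥ z = (Hᵀ * R⁻¹ * H + P⁻¹) *ᵥ
      (z + (P * Hᵀ * (R + H * P * Hᵀ)⁻¹) *ᵥ (y - H *ᵥ z)) := by
    rw [mulVec_add, mulVec_mulVec _ _ (P * Hᵀ * (R + H * P * Hᵀ)⁻¹),
      information_mul_gain hP hR H, add_mulVec, mulVec_sub]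
    simp only [mulVec_mulVec, Matrix.mul_assoc]
    abel
  rw [h, mulVec_mulVec, nonsing_inv_mul _ hdS, one_mulVec]

theorem gain_transpose_mul_information_mul_gain (hP : P.PosDef) (hR : R.PosDef)
    (H : Matrix (Fin m) (Fin n) ℝ) :
    (P * Hᵀ * (R + H * P * Hᵀ)⁻¹)ᵀ * (Hᵀ * R⁻¹ * H + P⁻¹) *
      (P * Hᵀ * (R + H * P * Hᵀ)⁻¹) + (R + H * P * Hᵀ)⁻¹ = R⁻¹ := by
  have hW := posDef_innovation hP hR H
  have hdR := (isUnit_iff_isUnit_det _).1 hR.isUnit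
  have hdW := (isUnit_iff_isUnit_det _).1 hW.isUnit
  have hK : (P * Hᵀ * (R + H * P * Hᵀ)⁻¹)ᵀ = (R + H * P * Hᵀ)⁻¹ * (H * P) := by
    rw [transpose_mul, hW.inv.transpose_eq_self, transpose_mul, transpose_transpose,
      hP.transpose_eq_self]
  rw [Matrix.mul_assoc, information_mul_gain hP hR H, hK]
  calc (R + H * P * Hᵀ)⁻¹ * (H * P) * (Hᵀ * R⁻¹) + (R + H * P * Hᵀ)⁻¹
      = (R + H * P * Hᵀ)⁻¹ * ((H * P * Hᵀ) * R⁻¹ + 1) := by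
        rw [Matrix.mul_add, Matrix.mul_one]; simp only [Matrix.mul_assoc]
    _ = (R + H * P * Hᵀ)⁻¹ * ((R + H * P * Hᵀ) * R⁻¹) := by
        rw [Matrix.add_mul R, mul_nonsing_inv _ hdR, add_comm 1]
    _ = R⁻¹ := nonsing_inv_mul_cancel_left _ _ hdW

/-- Completion of the square for a single linear measurement. -/
theorem qf_measurement_add_qf_prior (hP : P.PosDef) (hR : R.PosDef)
    (H : Matrix (Fin m) (Fin n) ℝ) (y : Fin m → ℝ) (z ξ : Fin n → ℝ) :
    qf R⁻¹ (y - H *ᵥ ξ) + qf P⁻¹ (ξ - z) =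
      qf (Hᵀ * R⁻¹ * H + P⁻¹)
          (ξ - (Hᵀ * R⁻¹ * H + P⁻¹)⁻¹ *ᵥ (Hᵀ *ᵥ (R⁻¹ *ᵥ y) + P⁻¹ *ᵥ z)) +
        qf (R + H * P * Hᵀ)⁻¹ (y - H *ᵥ z) := by
  have hy : y - H *ᵥ ξ = (y - H *ᵥ z) - H *ᵥ (ξ - z) := by
    rw [mulVec_sub]; abel
  rw [inv_information_mulVec hP hR H, ← sub_sub, hy]
  generalize y - H *ᵥ z = r
  generalize ξ - z = e
  have hcross : r ⬝ᵥ R⁻¹ *ᵥ (H *ᵥ e) = e ⬝ᵥ (Hᵀ * R⁻¹) *ᵥ r := by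
    rw [dotProduct_comm, dotProduct_mulVec e, ← vecMul_vecMul, vecMul_transpose,
      ← dotProduct_mulVec, dotProduct_mulVec (H *ᵥ e), ← mulVec_transpose,
      hR.inv.transpose_eq_self]
  rw [qf_sub hR.inv.transpose_eq_self,
    qf_sub (posDef_information hP hR H).transpose_eq_self, qf_mulVec, qf_mulVec, hcross,
    mulVec_mulVec _ _ (P * Hᵀ * _), information_mul_gain hP hR H, qf_add_matrix _ _ e]
  have hr := qf_add_matrix ((P * Hᵀ * (R + H * P * Hᵀ)⁻¹)ᵀ * (Hᵀ * R⁻¹ * H + P⁻¹) *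
      (P * Hᵀ * (R + H * P * Hᵀ)⁻¹)) (R + H * P * Hᵀ)⁻¹ r
  rw [gain_transpose_mul_information_mul_gain hP hR H] at hr
  linarith

end MeasurementUpdate

/-- (One-step forward dynamic-programming update.) With
`P⁺ = Q + F P Fᵀ − F P Hᵀ (R + H P Hᵀ)⁻¹ H P Fᵀ`,
`x̆⁺ = F x̆ + F P Hᵀ (R + H P Hᵀ)⁻¹ (y − H x̆)`,
`c⁺ = c + |H x̆ − y|²_{(R + H P Hᵀ)⁻¹}` and `S = Fᵀ Q⁻¹ F + Hᵀ R⁻¹ H + P⁻¹`,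
the function `ξ ↦ |x − F ξ|²_{Q⁻¹} + |y − H ξ|²_{R⁻¹} + |ξ − x̆|²_{P⁻¹} + c` attains its
minimum at `ξ* = S⁻¹ (Fᵀ Q⁻¹ x + Hᵀ R⁻¹ y + P⁻¹ x̆)`, and the minimum equals
`|x − x̆⁺|²_{(P⁺)⁻¹} + c⁺`. -/
theorem one_step_dp_update {n m : ℕ}
    (F : Matrix (Fin n) (Fin n) ℝ) (H : Matrix (Fin m) (Fin n) ℝ)
    (Q P : Matrix (Fin n) (Fin n) ℝ) (R : Matrix (Fin m) (Fin m) ℝ)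
    (hQ : Q.PosDef) (hP : P.PosDef) (hR : R.PosDef)
    (xbr : Fin n → ℝ) (y : Fin m → ℝ) (c : ℝ)
    (Pp : Matrix (Fin n) (Fin n) ℝ)
    (hPp : Pp = Q + F * P * Fᵀ - F * P * Hᵀ * (R + H * P * Hᵀ)⁻¹ * (H * P * Fᵀ))
    (xbrp : Fin n → ℝ)
    (hxbrp : xbrp = F *ᵥ xbr + (F * P * Hᵀ * (R + H * P * Hᵀ)⁻¹) *ᵥ (y - H *ᵥ xbr))
    (cp : ℝ) (hcp : cp = c + qf (R + H * P * Hᵀ)⁻¹ (H *ᵥ xbr - y))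
    (S : Matrix (Fin n) (Fin n) ℝ) (hS : S = Fᵀ * Q⁻¹ * F + Hᵀ * R⁻¹ * H + P⁻¹)
    (x : Fin n → ℝ)
    (ξstar : Fin n → ℝ)
    (hξstar : ξstar = S⁻¹ *ᵥ (Fᵀ *ᵥ (Q⁻¹ *ᵥ x) + Hᵀ *ᵥ (R⁻¹ *ᵥ y) + P⁻¹ *ᵥ xbr)) :
    (∀ ξ : Fin n → ℝ,
        qf Q⁻¹ (x - F *ᵥ ξstar) + qf R⁻¹ (y - H *ᵥ ξstar) + qf P⁻¹ (ξstar - xbr) + c ≤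
          qf Q⁻¹ (x - F *ᵥ ξ) + qf R⁻¹ (y - H *ᵥ ξ) + qf P⁻¹ (ξ - xbr) + c) ∧
      qf Q⁻¹ (x - F *ᵥ ξstar) + qf R⁻¹ (y - H *ᵥ ξstar) + qf P⁻¹ (ξstar - xbr) + c =
        qf Pp⁻¹ (x - xbrp) + cp := by
  set T := Hᵀ * R⁻¹ * H + P⁻¹ with hT
  set z := T⁻¹ *ᵥ (Hᵀ *ᵥ (R⁻¹ *ᵥ y) + P⁻¹ *ᵥ xbr) with hz
  have hTpos : T.PosDef := posDef_information hP hR H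
  have hdT := (isUnit_iff_isUnit_det _).1 hTpos.isUnit
  have hTT : T⁻¹⁻¹ = T := nonsing_inv_nonsing_inv _ hdT
  have hST : S = Fᵀ * Q⁻¹ * F + T⁻¹⁻¹ := by rw [hS, hTT, hT, add_assoc]
  have hSpos : S.PosDef := hST ▸ posDef_information hTpos.inv hQ F
  have hξ : ξstar = S⁻¹ *ᵥ (Fᵀ *ᵥ (Q⁻¹ *ᵥ x) + T⁻¹⁻¹ *ᵥ z) := by
    rw [hξstar, hTT, hz, mulVec_mulVec _ T, mul_nonsing_inv _ hdT, one_mulVec, add_assoc]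
  have hPpT : Q + F * T⁻¹ * Fᵀ = Pp := by
    rw [hPp, hT, inv_information hP hR H, Matrix.mul_sub, Matrix.sub_mul, add_sub_assoc]
    simp only [Matrix.mul_assoc]
  have hFz : F *ᵥ z = xbrp := by
    rw [hxbrp, hz, hT, inv_information_mulVec hP hR H, mulVec_add, mulVec_mulVec]
    simp only [Matrix.mul_assoc]
  have hcp' : cp = c + qf (R + H * P * Hᵀ)⁻¹ (y - H *ᵥ xbr) := by
    rw [hcp, ← qf_neg, neg_sub]
  have key (ξ : Fin n → ℝ) :
      qf Q⁻¹ (x - F *ᵥ ξ) + qf R⁻¹ (y - H *ᵥ ξ) + qf P⁻¹ (ξ - xbr) + c =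
        qf S (ξ - ξstar) + (qf Pp⁻¹ (x - xbrp) + cp) := by
    have h₁ := qf_measurement_add_qf_prior hP hR H y xbr ξ
    have h₂ := qf_measurement_add_qf_prior hTpos.inv hQ F x z ξ
    rw [← hT, ← hz] at h₁
    rw [← hST, ← hξ, hPpT, hFz, hTT] at h₂
    linarith
  have hmin := key ξstar
  rw [sub_self, qf_zero, zero_add] at hmin
  refine ⟨fun ξ => ?_, hmin⟩
  rw [hmin, key ξ]
  exact le_add_of_nonneg_left (qf_nonneg hSpos _)
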